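/- Let A, B, X, Y, A', B', X', Y' be random variables on a common probability space, each taking finitely many values. Then 5·(H[A,B] + 4H[A,X,Y] + H[B,X,Y] + H[A',B'] + 4H[A',X',Y'] + H[B',X',Y']) + H[A',A] + 2H[X',A] + 2H[Y',A] + 2H[A',X] + 4H[X',X] + 4H[Y',X] + 2H[A',Y] + 4H[X',Y] + 4H[Y',Y] ≤ 5·(3H[X,Y] + 3H[A,X] + 3H[A,Y] + H[B,X] + H[B,Y] + 3H[X',Y'] + 3H[A',X'] + 3H[A',Y'] + H[B',X'] + H[B',Y']). -/

import Mathlib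

/-- Shannon entropy (base 2) of the random variable `f` on a finite
probability space with mass function `p`. -/
noncomputable def entropy {Ω α : Type*} [Fintype Ω] (p : Ω → ℝ) (f : Ω → α) : ℝ :=
  letI := Classical.decEq α
  ∑ y ∈ Finset.univ.image f,
    -((∑ ω ∈ Finset.univ.filter (fun ω => f ω = y), p ω) *
        Real.logb 2 (∑ ω ∈ Finset.univ.filter (fun ω => f ω = y), p ω))

open Classical in
/-- The mass of the fibre of `f` through `ω`. -/
noncomputable def fiberMass {Ω α : Type*} [Fintype Ω] (p : Ω → ℝ) (f : Ω → α) (ω : Ω) : ℝ :=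
  ∑ ω', if f ω' = f ω then p ω' else 0

section Entropy

variable {Ω Ω' α β γ δ : Type*} [Fintype Ω] [Fintype Ω'] {p : Ω → ℝ}

theorem fiberMass_nonneg (hp : ∀ ω, 0 ≤ p ω) (f : Ω → α) (ω : Ω) : 0 ≤ fiberMass p f ω :=
  Finset.sum_nonneg fun ω' _ => by split_ifs <;> simp [hp]

theorem le_fiberMass (hp : ∀ ω, 0 ≤ p ω) (f : Ω → α) (ω : Ω) : p ω ≤ fiberMass p f ω := by
  classical
  have h := Finset.single_le_sum (f := fun ω' => if f ω' = f ω then p ω' else 0)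
    (fun ω' _ => by split_ifs <;> simp [hp]) (Finset.mem_univ ω)
  simpa [fiberMass] using h

theorem fiberMass_congr {f : Ω → α} {ω ω' : Ω} (h : f ω = f ω') :
    fiberMass p f ω = fiberMass p f ω' := by
  unfold fiberMass
  rw [h]

theorem entropy_eq_sum (p : Ω → ℝ) (f : Ω → α) :
    entropy p f = ∑ ω, p ω * -Real.logb 2 (fiberMass p f ω) := by
  classical
  rw [← Finset.sum_fiberwise_of_maps_to (s := Finset.univ) (t := Finset.univ.image f) (g := f)
    (fun ω _ => Finset.mem_image_of_mem f (Finset.mem_univ ω))]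
  have key : ∀ y ∈ Finset.univ.image f,
      ∑ ω with f ω = y, p ω * -Real.logb 2 (fiberMass p f ω) =
        -((∑ ω with f ω = y, p ω) * Real.logb 2 (∑ ω with f ω = y, p ω)) := by
    intro y _
    rw [← mul_neg, Finset.sum_mul]
    refine Finset.sum_congr rfl fun ω hω => ?_
    rw [Finset.mem_filter] at hω
    rw [fiberMass, hω.2, Finset.sum_filter]
  rw [Finset.sum_congr rfl key, entropy]

theorem entropy_id (p : Ω → ℝ) : entropy p id = ∑ ω, p ω * -Real.logb 2 (p ω) := by
  rw [entropy_eq_sum]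
  refine Finset.sum_congr rfl fun ω _ => ?_
  rw [fiberMass, Finset.sum_eq_single ω, if_pos rfl]
  · exact fun ω' _ h => if_neg h
  · exact fun h => absurd (Finset.mem_univ ω) h

theorem sum_mul_fiberMass_div_le (hp : ∀ ω, 0 ≤ p ω) {f : Ω → α} {g : Ω → β} {k : Ω → γ}
    {h : Ω → δ} (hk : ∀ ω ω', k ω = k ω' ↔ f ω = f ω' ∧ g ω = g ω')
    (hf : ∀ ω ω', f ω = f ω' → h ω = h ω') (hg : ∀ ω ω', g ω = g ω' → h ω = h ω') :
    ∑ ω, p ω * (fiberMass p f ω * fiberMass p g ω / (fiberMass p k ω * fiberMass p h ω)) ≤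
      ∑ ω, p ω := by
  classical
  have inner : ∀ a b, (∑ ω, if f a = f ω ∧ g b = g ω then
      p ω / (fiberMass p k ω * fiberMass p h ω) else 0) ≤
        if h b = h a then 1 / fiberMass p h a else 0 := by
    intro a b
    by_cases hex : ∃ ω, f a = f ω ∧ g b = g ω
    · obtain ⟨ω₀, h₁, h₂⟩ := hex
      have ha := hf _ _ h₁
      have hb := hg _ _ h₂
      rw [if_pos (hb.trans ha.symm)]
      have : ∀ ω, (if f a = f ω ∧ g b = g ω then
          p ω / (fiberMass p k ω * fiberMass p h ω) else 0) =
          (if k ω = k ω₀ then p ω else 0) * (1 / (fiberMass p k ω₀ * fiberMass p h a)) := by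
        intro ω
        by_cases hω : k ω = k ω₀
        · have h₃ := (hk _ _).1 hω
          rw [if_pos ⟨h₁.trans h₃.1.symm, h₂.trans h₃.2.symm⟩, if_pos hω, fiberMass_congr hω,
            fiberMass_congr ((hf _ _ h₃.1).trans ha.symm)]
          ring
        · rw [if_neg hω, if_neg, zero_mul]
          rintro ⟨h₃, h₄⟩
          exact hω ((hk _ _).2 ⟨h₃.symm.trans h₁, h₄.symm.trans h₂⟩)
      rw [Finset.sum_congr rfl fun ω _ => this ω, ← Finset.sum_mul]
      change fiberMass p k ω₀ * _ ≤ _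
      by_cases h0 : fiberMass p k ω₀ = 0
      · rw [h0, zero_mul]
        exact one_div_nonneg.2 (fiberMass_nonneg hp h a)
      · rw [one_div, one_div, mul_inv, mul_inv_cancel_left₀ h0]
    · rw [Finset.sum_eq_zero]
      · split_ifs
        · exact one_div_nonneg.2 (fiberMass_nonneg hp h a)
        · exact le_rfl
      · intro ω _
        exact if_neg fun hω => hex ⟨ω, hω⟩
  calc _ = ∑ ω, ∑ a, ∑ b, p a * p b * (if f a = f ω ∧ g b = g ω then
            p ω / (fiberMass p k ω * fiberMass p h ω) else 0) := by
        refine Finset.sum_congr rfl fun ω _ => ?_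
        rw [fiberMass, fiberMass, Finset.sum_mul_sum, Finset.sum_div, Finset.mul_sum]
        refine Finset.sum_congr rfl fun a _ => ?_
        rw [Finset.sum_div, Finset.mul_sum]
        refine Finset.sum_congr rfl fun b _ => ?_
        by_cases h₁ : f a = f ω <;> by_cases h₂ : g b = g ω <;> simp [h₁, h₂]
        ring
    _ = ∑ a, ∑ b, p a * p b * ∑ ω, (if f a = f ω ∧ g b = g ω then
            p ω / (fiberMass p k ω * fiberMass p h ω) else 0) := by
        rw [Finset.sum_comm]
        refine Finset.sum_congr rfl fun a _ => ?_
        rw [Finset.sum_comm]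
        simp only [Finset.mul_sum]
    _ ≤ ∑ a, ∑ b, p a * p b * (if h b = h a then 1 / fiberMass p h a else 0) := by
        gcongr with a _ b _
        · exact mul_nonneg (hp a) (hp b)
        · exact inner a b
    _ = ∑ a, p a * (fiberMass p h a / fiberMass p h a) := by
        refine Finset.sum_congr rfl fun a _ => ?_
        conv_rhs => rw [div_eq_mul_one_div]; enter [2, 1]; rw [fiberMass]
        rw [Finset.sum_mul, Finset.mul_sum]
        refine Finset.sum_congr rfl fun b _ => ?_
        split_ifs <;> ring
    _ ≤ ∑ a, p a := by
        gcongr with a _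
        exact mul_le_of_le_one_right (hp a) (div_self_le_one _)

/-- Submodularity of entropy, where `k` generates the join of `f` and `g`, and `h` is a function
of each of them. -/
theorem entropy_submodular (hp : ∀ ω, 0 ≤ p ω) {f : Ω → α} {g : Ω → β} {k : Ω → γ}
    {h : Ω → δ} (hk : ∀ ω ω', k ω = k ω' ↔ f ω = f ω' ∧ g ω = g ω')
    (hf : ∀ ω ω', f ω = f ω' → h ω = h ω') (hg : ∀ ω ω', g ω = g ω' → h ω = h ω') :
    entropy p k + entropy p h ≤ entropy p f + entropy p g := by
  have key : ∀ ω, p ω * -Real.logb 2 (fiberMass p k ω) + p ω * -Real.logb 2 (fiberMass p h ω) -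
      p ω * -Real.logb 2 (fiberMass p f ω) - p ω * -Real.logb 2 (fiberMass p g ω) ≤
      (p ω * (fiberMass p f ω * fiberMass p g ω / (fiberMass p k ω * fiberMass p h ω)) - p ω) /
        Real.log 2 := by
    intro ω
    rcases (hp ω).eq_or_lt with h0 | h0
    · simp [← h0]
    have hF := h0.trans_le (le_fiberMass hp f ω)
    have hG := h0.trans_le (le_fiberMass hp g ω)
    have hK := h0.trans_le (le_fiberMass hp k ω)
    have hH := h0.trans_le (le_fiberMass hp h ω)
    have hlog := Real.log_le_sub_one_of_pos (div_pos (mul_pos hF hG) (mul_pos hK hH))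
    rw [Real.log_div (mul_pos hF hG).ne' (mul_pos hK hH).ne', Real.log_mul hF.ne' hG.ne',
      Real.log_mul hK.ne' hH.ne'] at hlog
    have h2 : 0 < Real.log 2 := Real.log_pos one_lt_two
    rw [le_div_iff₀ h2]
    simp only [Real.logb]
    have := mul_le_mul_of_nonneg_left hlog h0.le
    field_simp at this ⊢
    linarith
  have hsum := Finset.sum_le_sum fun ω (_ : ω ∈ Finset.univ) => key ω
  rw [← Finset.sum_div] at hsum
  simp only [Finset.sum_sub_distrib, Finset.sum_add_distrib, ← entropy_eq_sum] at hsum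
  have := div_nonpos_of_nonpos_of_nonneg
    (sub_nonpos.2 (sum_mul_fiberMass_div_le hp hk hf hg)) (Real.log_nonneg one_le_two)
  linarith

theorem entropy_const (hp1 : ∑ ω, p ω = 1) (c : α) : entropy p (fun _ => c) = 0 := by
  simp [entropy_eq_sum, fiberMass, hp1]

theorem entropy_pair_le_add (hp : ∀ ω, 0 ≤ p ω) (hp1 : ∑ ω, p ω = 1) (f : Ω → α) (g : Ω → β) :
    entropy p (fun ω => (f ω, g ω)) ≤ entropy p f + entropy p g := by
  have := entropy_submodular hp (f := f) (g := g) (k := fun ω => (f ω, g ω))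
    (h := fun _ => ()) (by simp) (by simp) (by simp)
  rwa [entropy_const hp1, add_zero] at this

theorem entropy_comp_of_marginal {q : Ω' → ℝ} {π : Ω' → Ω}
    (h : ∀ u : Ω → ℝ, ∑ x, q x * u (π x) = ∑ ω, p ω * u ω) (f : Ω → α) :
    entropy q (fun x => f (π x)) = entropy p f := by
  classical
  have hm : ∀ x, fiberMass q (fun x => f (π x)) x = fiberMass p f (π x) := by
    intro x
    simpa [fiberMass] using h fun ω => if f ω = f (π x) then 1 else 0
  simp only [entropy_eq_sum, hm]
  exact h fun ω => -Real.logb 2 (fiberMass p f ω)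

/-- Two conditionally independent copies of a finite probability space over a random variable. -/
theorem exists_condIndep_copies (hp : ∀ ω, 0 ≤ p ω) (Z : Ω → α)
    [Fintype {x : Ω × Ω // Z x.1 = Z x.2}] :
    ∃ q : {x : Ω × Ω // Z x.1 = Z x.2} → ℝ, (∀ x, 0 ≤ q x) ∧
      (∀ u : Ω → ℝ, ∑ x, q x * u x.1.1 = ∑ ω, p ω * u ω) ∧
      (∀ u : Ω → ℝ, ∑ x, q x * u x.1.2 = ∑ ω, p ω * u ω) ∧
      entropy q id + entropy q (fun x => Z x.1.1) =
        entropy q (fun x => x.1.1) + entropy q (fun x => x.1.2) := by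
  classical
  set q : {x : Ω × Ω // Z x.1 = Z x.2} → ℝ := fun x => p x.1.1 * p x.1.2 / fiberMass p Z x.1.1
  have cancel : ∀ ω, p ω * fiberMass p Z ω / fiberMass p Z ω = p ω := by
    intro ω
    by_cases h0 : fiberMass p Z ω = 0
    · have : p ω = 0 := le_antisymm (h0 ▸ le_fiberMass hp Z ω) (hp ω)
      simp [this]
    · exact mul_div_cancel_right₀ _ h0
  have hsum : ∀ F : Ω × Ω → ℝ, ∑ x : {x : Ω × Ω // Z x.1 = Z x.2}, F x.1 =
      ∑ a, ∑ b, if Z a = Z b then F (a, b) else 0 := by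
    intro F
    rw [← Fintype.sum_prod_type' (f := fun a b => if Z a = Z b then F (a, b) else 0),
      ← Finset.sum_filter, Finset.sum_subtype (p := fun x : Ω × Ω => Z x.1 = Z x.2)]
    simp
  have hfst : ∀ u : Ω → ℝ, ∑ x, q x * u x.1.1 = ∑ ω, p ω * u ω := by
    intro u
    rw [hsum fun x => p x.1 * p x.2 / fiberMass p Z x.1 * u x.1]
    refine Finset.sum_congr rfl fun a _ => ?_
    conv_rhs => rw [← cancel a]; enter [1, 1]; rw [fiberMass]
    rw [Finset.mul_sum, Finset.sum_div, Finset.sum_mul]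
    refine Finset.sum_congr rfl fun b _ => ?_
    by_cases hab : Z a = Z b
    · simp [hab]
    · simp [hab, Ne.symm hab]
  have hsnd : ∀ u : Ω → ℝ, ∑ x, q x * u x.1.2 = ∑ ω, p ω * u ω := by
    intro u
    rw [hsum fun x => p x.1 * p x.2 / fiberMass p Z x.1 * u x.2, Finset.sum_comm]
    refine Finset.sum_congr rfl fun b _ => ?_
    conv_rhs => rw [← cancel b]; enter [1, 1]; rw [fiberMass]
    rw [Finset.mul_sum, Finset.sum_div, Finset.sum_mul]
    refine Finset.sum_congr rfl fun a _ => ?_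
    by_cases hab : Z a = Z b
    · simp only [hab, if_true, fiberMass_congr hab]
      ring
    · simp [hab]
  refine ⟨q, fun x => div_nonneg (mul_nonneg (hp _) (hp _)) (fiberMass_nonneg hp _ _),
    hfst, hsnd, ?_⟩
  have h₁ : entropy q (fun x => x.1.1) = ∑ x, q x * -Real.logb 2 (p x.1.1) := by
    rw [hfst fun ω => -Real.logb 2 (p ω), ← entropy_id]
    exact entropy_comp_of_marginal hfst id
  have h₂ : entropy q (fun x => x.1.2) = ∑ x, q x * -Real.logb 2 (p x.1.2) := by
    rw [hsnd fun ω => -Real.logb 2 (p ω), ← entropy_id]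
    exact entropy_comp_of_marginal hsnd id
  have h₃ : entropy q (fun x => Z x.1.1) = ∑ x, q x * -Real.logb 2 (fiberMass p Z x.1.1) := by
    rw [hfst fun ω => -Real.logb 2 (fiberMass p Z ω), ← entropy_eq_sum]
    exact entropy_comp_of_marginal hfst Z
  rw [entropy_id, h₁, h₂, h₃, ← Finset.sum_add_distrib, ← Finset.sum_add_distrib]
  refine Finset.sum_congr rfl fun x _ => ?_
  by_cases h0 : q x = 0
  · simp [h0]
  have hx : p x.1.1 * p x.1.2 / fiberMass p Z x.1.1 ≠ 0 := h0
  have hm := (div_ne_zero_iff.1 hx).2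
  have hn := mul_ne_zero_iff.1 (div_ne_zero_iff.1 hx).1
  have : Real.logb 2 (q x) =
      Real.logb 2 (p x.1.1) + Real.logb 2 (p x.1.2) - Real.logb 2 (fiberMass p Z x.1.1) := by
    rw [← Real.logb_mul hn.1 hn.2, ← Real.logb_div (mul_ne_zero hn.1 hn.2) hm]
  rw [this]
  ring

/-- If `U` and `V` are conditionally independent given `(X, Y)`, then
`I(X;Y) ≤ I(X;Y|U) + I(X;Y|V) + I(U;V)`. -/
theorem ingleton_of_condIndep (hp : ∀ ω, 0 ≤ p ω) (U : Ω → α) (V : Ω → β) (X : Ω → γ)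
    (Y : Ω → δ)
    (h : entropy p (fun ω => (U ω, X ω, Y ω)) + entropy p (fun ω => (V ω, X ω, Y ω)) ≤
      entropy p (fun ω => (U ω, V ω, X ω, Y ω)) + entropy p (fun ω => (X ω, Y ω))) :
    entropy p X + entropy p Y + entropy p (fun ω => (U ω, X ω, Y ω)) +
        entropy p (fun ω => (V ω, X ω, Y ω)) + entropy p (fun ω => (U ω, V ω)) ≤
      entropy p (fun ω => (X ω, Y ω)) +
        entropy p (fun ω => (U ω, X ω)) + entropy p (fun ω => (U ω, Y ω)) +
        entropy p (fun ω => (V ω, X ω)) + entropy p (fun ω => (V ω, Y ω)) := by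
  have h₁ := entropy_submodular hp (f := fun ω => (U ω, V ω, X ω)) (g := fun ω => (U ω, V ω, Y ω))
    (k := fun ω => (U ω, V ω, X ω, Y ω)) (h := fun ω => (U ω, V ω))
    (by grind) (by grind) (by grind)
  have h₂ := entropy_submodular hp (f := fun ω => (U ω, X ω)) (g := fun ω => (V ω, X ω))
    (k := fun ω => (U ω, V ω, X ω)) (h := X) (by grind) (by grind) (by grind)
  have h₃ := entropy_submodular hp (f := fun ω => (U ω, Y ω)) (g := fun ω => (V ω, Y ω))
    (k := fun ω => (U ω, V ω, Y ω)) (h := Y) (by grind) (by grind) (by grind)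
  linarith

/-- The Zhang–Yeung inequality. -/
theorem zhang_yeung (hp : ∀ ω, 0 ≤ p ω) (A : Ω → α) (B : Ω → β) (X : Ω → γ) (Y : Ω → δ) :
    entropy p A + 2 * entropy p X + 2 * entropy p Y + entropy p (fun ω => (A ω, B ω)) +
        4 * entropy p (fun ω => (A ω, X ω, Y ω)) + entropy p (fun ω => (B ω, X ω, Y ω)) ≤
      3 * entropy p (fun ω => (X ω, Y ω)) + 3 * entropy p (fun ω => (A ω, X ω)) +
        3 * entropy p (fun ω => (A ω, Y ω)) + entropy p (fun ω => (B ω, X ω)) +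
        entropy p (fun ω => (B ω, Y ω)) := by
  classical
  obtain ⟨q, hq, hfst, hsnd, hind⟩ := exists_condIndep_copies hp (fun ω => (X ω, Y ω))
  have hX : ∀ x : {x : Ω × Ω // (X x.1, Y x.1) = (X x.2, Y x.2)}, X x.1.2 = X x.1.1 :=
    fun x => (Prod.ext_iff.1 x.2).1.symm
  have hY : ∀ x : {x : Ω × Ω // (X x.1, Y x.1) = (X x.2, Y x.2)}, Y x.1.2 = Y x.1.1 :=
    fun x => (Prod.ext_iff.1 x.2).2.symm
  have e₁ := entropy_comp_of_marginal hfst A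
  have e₂ := entropy_comp_of_marginal hfst X
  have e₃ := entropy_comp_of_marginal hfst Y
  have e₄ := entropy_comp_of_marginal hfst fun ω => (A ω, B ω)
  have e₅ := entropy_comp_of_marginal hfst fun ω => (A ω, X ω, Y ω)
  have e₆ := entropy_comp_of_marginal hfst fun ω => (B ω, X ω, Y ω)
  have e₇ := entropy_comp_of_marginal hfst fun ω => (X ω, Y ω)
  have e₈ := entropy_comp_of_marginal hfst fun ω => (A ω, X ω)
  have e₉ := entropy_comp_of_marginal hfst fun ω => (A ω, Y ω)
  have e₁₀ := entropy_comp_of_marginal hfst fun ω => (B ω, X ω)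
  have e₁₁ := entropy_comp_of_marginal hfst fun ω => (B ω, Y ω)
  have c₁ := entropy_comp_of_marginal hsnd A
  have c₂ := entropy_comp_of_marginal hsnd fun ω => (A ω, X ω, Y ω)
  have c₃ := entropy_comp_of_marginal hsnd fun ω => (A ω, X ω)
  have c₄ := entropy_comp_of_marginal hsnd fun ω => (A ω, Y ω)
  simp only [hX, hY] at c₂ c₃ c₄
  -- The copy of `A` is conditionally independent of the first coordinate given `(X, Y)`.
  have i₁ := entropy_submodular hq (f := fun x => (x.1.1, A x.1.2)) (g := fun x => x.1.2)
    (k := id) (h := fun x => (A x.1.2, X x.1.1, Y x.1.1))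
    (by grind) (by grind) (by grind)
  have i₂ := entropy_submodular hq (f := fun x => x.1.1)
    (g := fun x => (A x.1.1, B x.1.1, A x.1.2, X x.1.1, Y x.1.1))
    (k := fun x => (x.1.1, A x.1.2)) (h := fun x => (A x.1.1, B x.1.1, X x.1.1, Y x.1.1))
    (by grind) (by grind) (by grind)
  have i₃ := entropy_submodular hq (f := fun x => (A x.1.1, B x.1.1, X x.1.1, Y x.1.1))
    (g := fun x => (A x.1.1, A x.1.2, X x.1.1, Y x.1.1))
    (k := fun x => (A x.1.1, B x.1.1, A x.1.2, X x.1.1, Y x.1.1))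
    (h := fun x => (A x.1.1, X x.1.1, Y x.1.1)) (by grind) (by grind) (by grind)
  have i₄ := entropy_submodular hq (f := fun x => (A x.1.1, B x.1.1, X x.1.1, Y x.1.1))
    (g := fun x => (B x.1.1, A x.1.2, X x.1.1, Y x.1.1))
    (k := fun x => (A x.1.1, B x.1.1, A x.1.2, X x.1.1, Y x.1.1))
    (h := fun x => (B x.1.1, X x.1.1, Y x.1.1)) (by grind) (by grind) (by grind)
  have j₁ := ingleton_of_condIndep hq (fun x => A x.1.1) (fun x => A x.1.2) (fun x => X x.1.1)
    (fun x => Y x.1.1) (by linarith)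
  have j₂ := ingleton_of_condIndep hq (fun x => B x.1.1) (fun x => A x.1.2) (fun x => X x.1.1)
    (fun x => Y x.1.1) (by linarith)
  -- `I(A;A*) + I(B;A*) ≤ I(A;B) + I(A,B;A*)` and `I(A,B;A*) ≤ I(X,Y;A*)`.
  have k₁ := entropy_submodular hq (f := fun x => (A x.1.1, A x.1.2))
    (g := fun x => (B x.1.1, A x.1.2)) (k := fun x => (A x.1.1, B x.1.1, A x.1.2))
    (h := fun x => A x.1.2) (by grind) (by grind) (by grind)
  have k₂ := entropy_submodular hq (f := fun x => (A x.1.1, B x.1.1, A x.1.2))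
    (g := fun x => (A x.1.1, B x.1.1, X x.1.1, Y x.1.1))
    (k := fun x => (A x.1.1, B x.1.1, A x.1.2, X x.1.1, Y x.1.1))
    (h := fun x => (A x.1.1, B x.1.1)) (by grind) (by grind) (by grind)
  linarith

end Entropy

/-- The combined non-Shannon inequality on eight random variables
`A, B, X, Y, A', B', X', Y'` obtained from three instances of the
Zhang–Yeung inequality. -/
theorem non_shannon_eight_vars
    {Ω α₁ α₂ α₃ α₄ β₁ β₂ β₃ β₄ : Type*} [Fintype Ω]
    [Fintype α₁] [Fintype α₂] [Fintype α₃] [Fintype α₄]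
    [Fintype β₁] [Fintype β₂] [Fintype β₃] [Fintype β₄]
    (p : Ω → ℝ) (hp : ∀ ω, 0 ≤ p ω) (hp1 : ∑ ω, p ω = 1)
    (A : Ω → α₁) (B : Ω → α₂) (X : Ω → α₃) (Y : Ω → α₄)
    (A' : Ω → β₁) (B' : Ω → β₂) (X' : Ω → β₃) (Y' : Ω → β₄) :
    5 * (entropy p (fun ω => (A ω, B ω)) +
          4 * entropy p (fun ω => (A ω, X ω, Y ω)) +
          entropy p (fun ω => (B ω, X ω, Y ω)) +
          entropy p (fun ω => (A' ω, B' ω)) +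
          4 * entropy p (fun ω => (A' ω, X' ω, Y' ω)) +
          entropy p (fun ω => (B' ω, X' ω, Y' ω))) +
      entropy p (fun ω => (A' ω, A ω)) +
      2 * entropy p (fun ω => (X' ω, A ω)) +
      2 * entropy p (fun ω => (Y' ω, A ω)) +
      2 * entropy p (fun ω => (A' ω, X ω)) +
      4 * entropy p (fun ω => (X' ω, X ω)) +
      4 * entropy p (fun ω => (Y' ω, X ω)) +
      2 * entropy p (fun ω => (A' ω, Y ω)) +
      4 * entropy p (fun ω => (X' ω, Y ω)) +
      4 * entropy p (fun ω => (Y' ω, Y ω)) ≤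
    5 * (3 * entropy p (fun ω => (X ω, Y ω)) +
          3 * entropy p (fun ω => (A ω, X ω)) +
          3 * entropy p (fun ω => (A ω, Y ω)) +
          entropy p (fun ω => (B ω, X ω)) +
          entropy p (fun ω => (B ω, Y ω)) +
          3 * entropy p (fun ω => (X' ω, Y' ω)) +
          3 * entropy p (fun ω => (A' ω, X' ω)) +
          3 * entropy p (fun ω => (A' ω, Y' ω)) +
          entropy p (fun ω => (B' ω, X' ω)) +
          entropy p (fun ω => (B' ω, Y' ω))) := by
  have zy := zhang_yeung hp A B X Y
  have zy' := zhang_yeung hp A' B' X' Y'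
  linarith [entropy_pair_le_add hp hp1 A' A, entropy_pair_le_add hp hp1 X' A,
    entropy_pair_le_add hp hp1 Y' A, entropy_pair_le_add hp hp1 A' X,
    entropy_pair_le_add hp hp1 X' X, entropy_pair_le_add hp hp1 Y' X,
    entropy_pair_le_add hp hp1 A' Y, entropy_pair_le_add hp hp1 X' Y,
    entropy_pair_le_add hp hp1 Y' Y]
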